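/- For a finite simple graph G the following are equivalent: (i) G is a König-Egerváry graph; (ii) there exists a maximum independent set of G that is a critical set; (iii) every maximum independent set of G is a critical set. -/

import Mathlib

/-- `S` is an independent set in `G`: no two of its vertices are adjacent. -/
def IndepSet {V : Type*} (G : SimpleGraph V) (S : Set V) : Prop :=
  ∀ ⦃u⦄, u ∈ S → ∀ ⦃v⦄, v ∈ S → ¬G.Adj u v

/-- The independence number `α(G)`. -/
noncomputable def indNum {V : Type*} (G : SimpleGraph V) : ℕ :=
  sSup {n : ℕ | ∃ S : Set V, IndepSet G S ∧ S.ncard = n}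

/-- `Ω(G)`: the family of maximum independent sets of `G`. -/
def maxIndepFam {V : Type*} (G : SimpleGraph V) : Set (Set V) :=
  {S | IndepSet G S ∧ S.ncard = indNum G}

/-- `N(X)`: the neighborhood of a set of vertices. -/
def nbhd {V : Type*} (G : SimpleGraph V) (X : Set V) : Set V :=
  {v | ∃ x ∈ X, G.Adj v x}

/-- `N[X] = N(X) ∪ X`: the closed neighborhood of a set of vertices. -/
def closedNbhd {V : Type*} (G : SimpleGraph V) (X : Set V) : Set V :=
  nbhd G X ∪ X

/-- The difference `d(X) = |X| - |N(X)|`. -/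
noncomputable def diffd {V : Type*} (G : SimpleGraph V) (X : Set V) : ℤ :=
  (X.ncard : ℤ) - ((nbhd G X).ncard : ℤ)

/-- The critical difference `d(G) = max {d(X) : X ⊆ V(G)}`. -/
noncomputable def critDiff {V : Type*} (G : SimpleGraph V) : ℤ :=
  sSup {d : ℤ | ∃ X : Set V, diffd G X = d}

/-- `X` is a critical set if `d(X) = d(G)`. -/
def IsCritical {V : Type*} (G : SimpleGraph V) (X : Set V) : Prop :=
  diffd G X = critDiff G

/-- `MaxCritIndep(G)`: the family of critical independent sets of maximum cardinality. -/
def maxCritIndepFam {V : Type*} (G : SimpleGraph V) : Set (Set V) :=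
  {S | IndepSet G S ∧ IsCritical G S ∧
    ∀ T : Set V, IndepSet G T → IsCritical G T → T.ncard ≤ S.ncard}

/-- The critical independence number `α'(G)`. -/
noncomputable def critIndNum {V : Type*} (G : SimpleGraph V) : ℕ :=
  sSup {n : ℕ | ∃ S : Set V, IndepSet G S ∧ IsCritical G S ∧ S.ncard = n}

/-- `ker(G)`: the intersection of all critical independent sets. -/
def kerSet {V : Type*} (G : SimpleGraph V) : Set V :=
  ⋂₀ {A : Set V | IndepSet G A ∧ IsCritical G A}

/-- `nucleus(G)`: the intersection of all maximum critical independent sets. -/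
def nucleus {V : Type*} (G : SimpleGraph V) : Set V :=
  ⋂₀ maxCritIndepFam G

/-- `diadem(G)`: the union of all maximum critical independent sets. -/
def diadem {V : Type*} (G : SimpleGraph V) : Set V :=
  ⋃₀ maxCritIndepFam G

/-- `core(G)`: the intersection of all maximum independent sets. -/
def coreSet {V : Type*} (G : SimpleGraph V) : Set V :=
  ⋂₀ maxIndepFam G

/-- `corona(G)`: the union of all maximum independent sets. -/
def coronaSet {V : Type*} (G : SimpleGraph V) : Set V :=
  ⋃₀ maxIndepFam G

/-- A matching in `G`: a set of pairwise non-incident edges of `G`. -/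
def IsMatchingSet {V : Type*} (G : SimpleGraph V) (M : Set (Sym2 V)) : Prop :=
  M ⊆ G.edgeSet ∧ M.Pairwise fun e f => ∀ v, v ∈ e → v ∉ f

/-- The matching number `μ(G)`. -/
noncomputable def matchNum {V : Type*} (G : SimpleGraph V) : ℕ :=
  sSup {n : ℕ | ∃ M : Set (Sym2 V), IsMatchingSet G M ∧ M.ncard = n}

/-- `G` is a König-Egerváry graph if `α(G) + μ(G) = |V(G)|`. -/
def IsKonigEgervary {V : Type*} (G : SimpleGraph V) : Prop :=
  indNum G + matchNum G = Nat.card V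

/-- `Γ` is a König-Egerváry collection: a family of independent sets with
`|⋂Γ| + |⋃Γ| = 2α(G)`. -/
def IsKECollection {V : Type*} (G : SimpleGraph V) (Γ : Set (Set V)) : Prop :=
  (∀ S ∈ Γ, IndepSet G S) ∧ (⋂₀ Γ).ncard + (⋃₀ Γ).ncard = 2 * indNum G

section KonigEgervary

variable {V : Type*} [Finite V] (G : SimpleGraph V)

theorem IndepSet.ncard_le_indNum {G : SimpleGraph V} {S : Set V} (hS : IndepSet G S) :
    S.ncard ≤ indNum G := by
  refine le_csSup ⟨Nat.card V, ?_⟩ ⟨S, hS, rfl⟩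
  rintro _ ⟨T, -, rfl⟩
  exact Set.ncard_le_card T

theorem maxIndepFam_nonempty : (maxIndepFam G).Nonempty := by
  refine Nat.sSup_mem (s := {n : ℕ | ∃ S : Set V, IndepSet G S ∧ S.ncard = n})
    ⟨0, ∅, by simp [IndepSet], by simp⟩ ⟨Nat.card V, ?_⟩
  rintro _ ⟨T, -, rfl⟩
  exact Set.ncard_le_card T

theorem bddAbove_matchingSet_ncard :
    BddAbove {n : ℕ | ∃ M : Set (Sym2 V), IsMatchingSet G M ∧ M.ncard = n} := by
  refine ⟨Nat.card (Sym2 V), ?_⟩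
  rintro _ ⟨T, -, rfl⟩
  exact Set.ncard_le_card T

theorem IsMatchingSet.ncard_le_matchNum {G : SimpleGraph V} {M : Set (Sym2 V)}
    (hM : IsMatchingSet G M) : M.ncard ≤ matchNum G :=
  le_csSup (bddAbove_matchingSet_ncard G) ⟨M, hM, rfl⟩

theorem exists_isMatchingSet_ncard_eq_matchNum :
    ∃ M : Set (Sym2 V), IsMatchingSet G M ∧ M.ncard = matchNum G :=
  Nat.sSup_mem (s := {n : ℕ | ∃ M : Set (Sym2 V), IsMatchingSet G M ∧ M.ncard = n})
    ⟨0, ∅, by simp [IsMatchingSet], by simp⟩ (bddAbove_matchingSet_ncard G)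

theorem finite_range_diffd : {d : ℤ | ∃ X : Set V, diffd G X = d}.Finite :=
  Set.finite_range (diffd G)

theorem diffd_le_critDiff (X : Set V) : diffd G X ≤ critDiff G :=
  le_csSup (finite_range_diffd G).bddAbove ⟨X, rfl⟩

theorem isCritical_of_forall_diffd_le {G : SimpleGraph V} {X : Set V}
    (h : ∀ Y, diffd G Y ≤ diffd G X) : IsCritical G X := by
  refine le_antisymm (diffd_le_critDiff G X) (csSup_le ⟨_, X, rfl⟩ ?_)
  rintro _ ⟨Y, rfl⟩
  exact h Y

/-- A matching with `m` edges covers `2 * m` vertices. -/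
theorem IsMatchingSet.ncard_covered {G : SimpleGraph V} {M : Set (Sym2 V)}
    (hM : IsMatchingSet G M) : {v | ∃ e ∈ M, v ∈ e}.ncard = 2 * M.ncard := by
  classical
  have := Fintype.ofFinite V
  have hcov : {v | ∃ e ∈ M, v ∈ e} = (M.toFinset.biUnion Sym2.toFinset : Finset V) := by
    ext v
    simp
  rw [hcov, Set.ncard_coe_finset, Finset.card_biUnion, Finset.sum_congr rfl (g := fun _ => 2),
    Finset.sum_const, Set.ncard_eq_toFinset_card', smul_eq_mul, mul_comm]
  · intro e he
    exact Sym2.card_toFinset_of_not_isDiag e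
      (G.not_isDiag_of_mem_edgeSet (hM.1 (Set.mem_toFinset.mp he)))
  · intro e he f hf hef
    rw [Function.onFun, Finset.disjoint_left]
    intro v hv hv'
    exact hM.2 (Set.mem_toFinset.mp he) (Set.mem_toFinset.mp hf) hef v
      (Sym2.mem_toFinset.mp hv) (Sym2.mem_toFinset.mp hv')

/-- The vertices of `X` covered by a matching are matched injectively into `N(X)`. -/
theorem IsMatchingSet.ncard_inter_covered_le {G : SimpleGraph V} {M : Set (Sym2 V)}
    (hM : IsMatchingSet G M) (X : Set V) :
    (X ∩ {v | ∃ e ∈ M, v ∈ e}).ncard ≤ (nbhd G X).ncard := by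
  have hpartner : ∀ v ∈ X ∩ {v | ∃ e ∈ M, v ∈ e}, ∃ w, s(v, w) ∈ M := by
    rintro v ⟨-, e, he, w, rfl⟩
    exact ⟨w, he⟩
  choose! f hf using hpartner
  refine Set.ncard_le_ncard_of_injOn f (fun v hv => ⟨v, hv.1, (hM.1 (hf v hv)).symm⟩) ?_
  intro v hv w hw hvw
  by_contra hne
  refine hM.2 (hf v hv) (hf w hw) ?_ (f v) (Sym2.mem_mk_right _ _)
    (hvw ▸ Sym2.mem_mk_right _ _)
  rw [hvw]
  exact fun h => hne (Sym2.congr_left.mp h)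

theorem diffd_le_card_sub_two_mul_matchNum (X : Set V) :
    diffd G X ≤ Nat.card V - 2 * matchNum G := by
  obtain ⟨M, hM, hcard⟩ := exists_isMatchingSet_ncard_eq_matchNum G
  have hX := Set.ncard_inter_add_ncard_sdiff_eq_ncard X {v | ∃ e ∈ M, v ∈ e}
  have hin := hM.ncard_inter_covered_le X
  have hout : (X \ {v | ∃ e ∈ M, v ∈ e}).ncard ≤ ({v | ∃ e ∈ M, v ∈ e}ᶜ).ncard :=
    Set.ncard_le_ncard fun v hv => hv.2
  have hcov := Set.ncard_add_ncard_compl {v | ∃ e ∈ M, v ∈ e}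
  have hM2 := hM.ncard_covered
  unfold diffd
  omega

theorem nbhd_eq_compl_of_mem_maxIndepFam {G : SimpleGraph V} {S : Set V}
    (hS : S ∈ maxIndepFam G) : nbhd G S = Sᶜ := by
  ext v
  refine ⟨fun ⟨x, hx, hvx⟩ hv => hS.1 hv hx hvx, fun hv => ?_⟩
  by_contra hN
  have hvS : ∀ x ∈ S, ¬G.Adj v x := fun x hx h => hN ⟨x, hx, h⟩
  have hins : IndepSet G (insert v S) := by
    rintro a (rfl | ha) b (rfl | hb)
    · exact G.irrefl
    · exact hvS b hb
    · exact fun h => hvS a ha h.symm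
    · exact hS.1 ha hb
  have hle := hins.ncard_le_indNum
  rw [Set.ncard_insert_of_notMem hv, hS.2] at hle
  omega

theorem diffd_of_mem_maxIndepFam {G : SimpleGraph V} {S : Set V} (hS : S ∈ maxIndepFam G) :
    diffd G S = 2 * indNum G - Nat.card V := by
  have hcompl := Set.ncard_add_ncard_compl S
  have hcard := hS.2
  rw [diffd, nbhd_eq_compl_of_mem_maxIndepFam hS]
  omega

theorem indNum_add_matchNum_le : indNum G + matchNum G ≤ Nat.card V := by
  obtain ⟨S, hS⟩ := maxIndepFam_nonempty G
  have h₁ := diffd_le_card_sub_two_mul_matchNum G S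
  have h₂ := diffd_of_mem_maxIndepFam hS
  omega

/-- Hall's condition for matching `Sᶜ` into a critical maximum independent set `S`. -/
theorem ncard_le_ncard_nbhd_inter {G : SimpleGraph V} {S : Set V} (hS : S ∈ maxIndepFam G)
    (hc : IsCritical G S) {A : Set V} (hA : A ⊆ Sᶜ) : A.ncard ≤ (nbhd G A ∩ S).ncard := by
  have hle : diffd G (S \ nbhd G A) ≤ diffd G S := hc ▸ diffd_le_critDiff G _
  have hN : (nbhd G (S \ nbhd G A)).ncard ≤ (nbhd G S \ A).ncard :=
    Set.ncard_le_ncard fun v ⟨x, hx, hvx⟩ =>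
      ⟨⟨x, hx.1, hvx⟩, fun hv => hx.2 ⟨v, hv, hvx.symm⟩⟩
  have hdiff := Set.ncard_sdiff_add_ncard_of_subset
    (hA.trans (nbhd_eq_compl_of_mem_maxIndepFam hS).ge)
  have hS2 := Set.ncard_inter_add_ncard_sdiff_eq_ncard S (nbhd G A)
  rw [Set.inter_comm] at hS2
  unfold diffd at hle
  omega

theorem exists_injective_compl_of_isCritical {G : SimpleGraph V} {S : Set V}
    (hS : S ∈ maxIndepFam G) (hc : IsCritical G S) :
    ∃ f : ↥Sᶜ → V, Function.Injective f ∧ ∀ v : ↥Sᶜ, G.Adj v (f v) ∧ f v ∈ S := by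
  classical
  have := Fintype.ofFinite V
  refine (Fintype.all_card_le_filter_rel_iff_exists_injective
    fun (v : ↥Sᶜ) w => G.Adj v w ∧ w ∈ S).mp fun A => ?_
  have h := ncard_le_ncard_nbhd_inter hS hc (A := Subtype.val '' (A : Set ↥Sᶜ))
    (Subtype.coe_image_subset _ _)
  rw [Set.ncard_image_of_injective _ Subtype.val_injective, Set.ncard_coe_finset] at h
  refine h.trans_eq ?_
  rw [← Set.ncard_coe_finset]
  congr 1
  ext w
  simp only [nbhd, Set.mem_inter_iff, Set.mem_ofPred_eq, Finset.coe_filter, Finset.mem_univ,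
    true_and, Set.mem_image, Finset.mem_coe]
  constructor
  · rintro ⟨⟨_, ⟨v, hv, rfl⟩, hadj⟩, hw⟩
    exact ⟨v, hv, hadj.symm, hw⟩
  · rintro ⟨v, hv, hadj, hw⟩
    exact ⟨⟨v, ⟨v, hv, rfl⟩, hadj.symm⟩, hw⟩

theorem isKonigEgervary_of_isCritical {G : SimpleGraph V} {S : Set V}
    (hS : S ∈ maxIndepFam G) (hc : IsCritical G S) : IsKonigEgervary G := by
  obtain ⟨f, hinj, hf⟩ := exists_injective_compl_of_isCritical hS hc
  have hmem : ∀ v w : ↥Sᶜ, ∀ x, x ∈ s((v : V), f v) → x ∈ s((w : V), f w) → v = w := by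
    intro v w x hx hx'
    rcases Sym2.mem_iff.mp hx with rfl | rfl <;> rcases Sym2.mem_iff.mp hx' with h | h
    · exact Subtype.ext h
    · exact absurd (h ▸ (hf w).2) v.2
    · exact absurd (h ▸ (hf v).2) w.2
    · exact hinj h
  have hM : IsMatchingSet G (Set.range fun v : ↥Sᶜ => s((v : V), f v)) := by
    constructor
    · rintro _ ⟨v, rfl⟩
      exact (hf v).1
    · rintro _ ⟨v, rfl⟩ _ ⟨w, rfl⟩ hne x hx hx'
      exact hne (by rw [hmem v w x hx hx'])
  have hedge : Function.Injective fun v : ↥Sᶜ => s((v : V), f v) := by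
    intro v w h
    refine hmem v w v (Sym2.mem_mk_left _ _) ?_
    rw [← show s((v : V), f v) = s((w : V), f w) from h]
    exact Sym2.mem_mk_left _ _
  have hle := hM.ncard_le_matchNum
  rw [Set.ncard_range_of_injective hedge, Nat.card_coe_set_eq] at hle
  have hcompl := Set.ncard_add_ncard_compl S
  have hcard := hS.2
  have hub := indNum_add_matchNum_le G
  unfold IsKonigEgervary
  omega

theorem IsKonigEgervary.isCritical {G : SimpleGraph V} (hG : IsKonigEgervary G) {S : Set V}
    (hS : S ∈ maxIndepFam G) : IsCritical G S := by
  refine isCritical_of_forall_diffd_le fun X => ?_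
  have h₁ := diffd_le_card_sub_two_mul_matchNum G X
  have h₂ := diffd_of_mem_maxIndepFam hS
  unfold IsKonigEgervary at hG
  omega

end KonigEgervary

/-- The following are equivalent: (i) `G` is a König-Egerváry graph;
(ii) some maximum independent set of `G` is a critical set; (iii) every maximum
independent set of `G` is a critical set. -/
theorem stmt18 {V : Type*} [Fintype V] (G : SimpleGraph V) :
    (IsKonigEgervary G ↔ ∃ S ∈ maxIndepFam G, IsCritical G S) ∧
    (IsKonigEgervary G ↔ ∀ S ∈ maxIndepFam G, IsCritical G S) := by
  obtain ⟨S, hS⟩ := maxIndepFam_nonempty G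
  exact ⟨⟨fun hG => ⟨S, hS, hG.isCritical hS⟩,
      fun ⟨_, hT, hc⟩ => isKonigEgervary_of_isCritical hT hc⟩,
    fun hG _ hT => hG.isCritical hT, fun h => isKonigEgervary_of_isCritical hS (h S hS)⟩
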